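/- arXiv:math/0607180 — 8 statements merged into one kernel-verified Lean document; each statement's English description precedes it below -/
import Mathlib

section
/- For every λ ∈ ℂ with |λ| < 1, every x ∈ ℂ, and every k ∈ ℕ, the k-th iterated derivative at t = 0 of the generating function F_λ(t,x) = 2 e^{xt}/(λ e^t + 1) equals E_k(λ; x); that is, (d^k/dt^k) [2 e^{xt}/(λ e^t + 1)]|_{t=0} = 2 ∑_{n=0}^∞ (-1)^n λ^n (n+x)^k. -/
open Complex

/-- The `λ`-Euler polynomial `E_k(λ; x) = 2 ∑_{n=0}^∞ (-1)^n λ^n (n+x)^k`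
(for `|λ| < 1` the series converges absolutely). -/
noncomputable def lambdaEulerPoly (lam x : ℂ) (k : ℕ) : ℂ :=
  2 * ∑' n : ℕ, (-1) ^ n * lam ^ n * ((n : ℂ) + x) ^ k

/-- Polynomial times geometric is summable. -/
theorem lamE_summable (r c : ℝ) (hr0 : 0 ≤ r) (hr : r < 1) (k : ℕ) :
    Summable fun n : ℕ => ((n : ℝ) + c) ^ k * r ^ n := by
  have h : ∀ n : ℕ, ((n : ℝ) + c) ^ k * r ^ n =
      ∑ m ∈ Finset.range (k + 1), (c ^ (k - m) * (k.choose m : ℝ)) * ((n : ℝ) ^ m * r ^ n) := by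
    intro n
    rw [add_pow, Finset.sum_mul]
    exact Finset.sum_congr rfl fun m _ => by ring
  simp_rw [h]
  refine summable_sum fun m _ => Summable.mul_left _ ?_
  exact summable_pow_mul_geometric_of_norm_lt_one m (by rwa [Real.norm_of_nonneg hr0])

/-- Termwise bound on a ball. -/
theorem lamE_bound (lam x t : ℂ) (d : ℝ) (ht : ‖t‖ ≤ d) (k n : ℕ) :
    ‖(-lam) ^ n * ((n : ℂ) + x) ^ k * Complex.exp (((n : ℂ) + x) * t)‖ ≤
      Real.exp (‖x‖ * d) * (((n : ℝ) + ‖x‖) ^ k * (‖lam‖ * Real.exp d) ^ n) := by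
  have h1 : ‖(n : ℂ) + x‖ ≤ (n : ℝ) + ‖x‖ := by
    simpa using norm_add_le (n : ℂ) x
  have h2 : ‖Complex.exp (((n : ℂ) + x) * t)‖ ≤ Real.exp (((n : ℝ) + ‖x‖) * d) := by
    refine (Complex.norm_exp_le_exp_norm _).trans (Real.exp_le_exp.2 ?_)
    rw [norm_mul]
    gcongr
  rw [norm_mul, norm_mul, norm_pow, norm_pow, norm_neg]
  calc ‖lam‖ ^ n * ‖(n : ℂ) + x‖ ^ k * ‖Complex.exp (((n : ℂ) + x) * t)‖
      ≤ ‖lam‖ ^ n * ((n : ℝ) + ‖x‖) ^ k * Real.exp (((n : ℝ) + ‖x‖) * d) := by gcongr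
    _ = _ := by
      rw [add_mul, Real.exp_add, Real.exp_nat_mul, mul_pow]; ring

/-- **Theorem 3.** For `|λ| < 1`, `x ∈ ℂ` and `k ∈ ℕ`, the `k`-th derivative at `t = 0`
of the generating function `F_λ(t,x) = 2 e^{xt}/(λ e^t + 1)` equals
`E_k(λ; x) = 2 ∑_{n=0}^∞ (-1)^n λ^n (n+x)^k`. -/
theorem iteratedDeriv_lambdaEuler_gen (lam : ℂ) (hlam : ‖lam‖ < 1) (x : ℂ) (k : ℕ) :
    iteratedDeriv k (fun t : ℂ => 2 * Complex.exp (x * t) / (lam * Complex.exp t + 1)) 0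
      = lambdaEulerPoly lam x k := by
  obtain ⟨d, hd1, hd0⟩ : ∃ d : ℝ, ‖lam‖ * Real.exp d < 1 ∧ 0 < d := by
    have hc : ContinuousAt (fun d : ℝ => ‖lam‖ * Real.exp d) 0 := by fun_prop
    have h := hc.eventually (gt_mem_nhds (show ‖lam‖ * Real.exp 0 < 1 by simpa using hlam))
    exact ((h.filter_mono nhdsWithin_le_nhds).and
      (self_mem_nhdsWithin : Set.Ioi (0 : ℝ) ∈ nhdsWithin 0 (Set.Ioi 0))).exists
  have hsum : ∀ j : ℕ, Summable fun n : ℕ =>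
      Real.exp (‖x‖ * d) * (((n : ℝ) + ‖x‖) ^ j * (‖lam‖ * Real.exp d) ^ n) := fun j =>
    (lamE_summable _ _ (by positivity) hd1 j).mul_left _
  have key : ∀ j : ℕ, ∀ t ∈ Metric.ball (0 : ℂ) d,
      iteratedDeriv j (fun t : ℂ => 2 * Complex.exp (x * t) / (lam * Complex.exp t + 1)) t
        = 2 * ∑' n : ℕ, (-lam) ^ n * ((n : ℂ) + x) ^ j * Complex.exp (((n : ℂ) + x) * t) := by
    intro j
    induction j with
    | zero =>
      intro t ht
      have ht' : ‖t‖ < d := by simpa using ht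
      have hlt : ‖-lam * Complex.exp t‖ < 1 := by
        rw [norm_mul, norm_neg]
        refine lt_of_le_of_lt ?_ hd1
        gcongr
        exact (Complex.norm_exp_le_exp_norm _).trans (Real.exp_le_exp.2 ht'.le)
      have he : ∀ n : ℕ, (-lam) ^ n * ((n : ℂ) + x) ^ 0 * Complex.exp (((n : ℂ) + x) * t)
          = Complex.exp (x * t) * (-lam * Complex.exp t) ^ n := by
        intro n
        rw [add_mul, Complex.exp_add, Complex.exp_nat_mul, mul_pow]; ring
      simp_rw [he]
      rw [tsum_mul_left, tsum_geometric_of_norm_lt_one hlt, iteratedDeriv_zero]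
      rw [show 1 - -lam * Complex.exp t = lam * Complex.exp t + 1 by ring]
      ring
    | succ j ih =>
      intro t ht
      rw [iteratedDeriv_succ]
      have hev : iteratedDeriv j
          (fun t : ℂ => 2 * Complex.exp (x * t) / (lam * Complex.exp t + 1)) =ᶠ[nhds t]
          fun t => 2 * ∑' n : ℕ, (-lam) ^ n * ((n : ℂ) + x) ^ j *
            Complex.exp (((n : ℂ) + x) * t) := by
        filter_upwards [Metric.isOpen_ball.mem_nhds ht] with y hy using ih y hy
      rw [hev.deriv_eq]
      refine HasDerivAt.deriv (HasDerivAt.const_mul _ ?_)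
      refine hasDerivAt_tsum_of_isPreconnected
        (g := fun (n : ℕ) (y : ℂ) => (-lam) ^ n * ((n : ℂ) + x) ^ j *
          Complex.exp (((n : ℂ) + x) * y))
        (g' := fun (n : ℕ) (y : ℂ) => (-lam) ^ n * ((n : ℂ) + x) ^ (j + 1) *
          Complex.exp (((n : ℂ) + x) * y))
        (hsum (j + 1)) Metric.isOpen_ball
        (convex_ball (0 : ℂ) d).isPreconnected (y₀ := t) ?_ ?_ ht ?_ ht
      · intro n y _
        have h1 : HasDerivAt (fun y : ℂ => ((n : ℂ) + x) * y) ((n : ℂ) + x) y := by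
          simpa using (hasDerivAt_id y).const_mul ((n : ℂ) + x)
        refine (h1.cexp.const_mul ((-lam) ^ n * ((n : ℂ) + x) ^ j)).congr_deriv ?_
        rw [pow_succ]
        ring
      · intro n y hy
        exact lamE_bound lam x y d (by simpa using (Metric.mem_ball.1 hy).le) (j + 1) n
      · exact Summable.of_norm_bounded (hsum j) fun n =>
          lamE_bound lam x t d (by simpa using (Metric.mem_ball.1 ht).le) j n
  rw [key k 0 (Metric.mem_ball_self hd0), lambdaEulerPoly]
  congr 1
  refine tsum_congr fun n => ?_
  rw [mul_zero, Complex.exp_zero, mul_one, neg_pow]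
end

section
/- For every λ ∈ ℂ with |λ| < 1, every real x > 0, and every k ∈ ℕ, the λ-zeta function of Hurwitz type satisfies ζ_λ(−k, x) = E_k(λ; x); that is, 2 ∑_{n=0}^∞ (-1)^n λ^n (n+x)^{k} (the value of ζ_λ(s,x) at s = −k) equals the k-th iterated derivative at t = 0 of t ↦ 2 e^{xt}/(λ e^t + 1). -/
open Complex

/-- The `λ`-zeta function of Hurwitz type
`ζ_λ(s, x) = 2 ∑_{n=0}^∞ (-1)^n λ^n (n+x)^{-s}`, where `(n+x)^{-s}` is the complex power
of the positive real number `n + x` (absolutely convergent for all `s` when `|λ| < 1`). -/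
noncomputable def lambdaZeta (lam : ℂ) (x : ℝ) (s : ℂ) : ℂ :=
  2 * ∑' n : ℕ, (-1) ^ n * lam ^ n * (((n : ℝ) + x : ℝ) : ℂ) ^ (-s)

lemma aux_summable (r x : ℝ) (hr0 : 0 ≤ r) (hr : r < 1) (hx : 0 < x) (k : ℕ) :
    Summable (fun n : ℕ => r ^ n * ((n : ℝ) + x) ^ k) := by
  have h1 : Summable (fun n : ℕ => (n : ℝ) ^ k * r ^ n) :=
    summable_pow_mul_geometric_of_norm_lt_one k (by rwa [Real.norm_of_nonneg hr0])
  have h2 : Summable (fun n : ℕ => x ^ k * r ^ n) :=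
    (summable_geometric_of_lt_one hr0 hr).mul_left _
  refine Summable.of_nonneg_of_le (fun n => by positivity) (fun n => ?_)
    ((h1.add h2).mul_left (2 ^ (k - 1)))
  have := add_pow_le (Nat.cast_nonneg (α := ℝ) n) hx.le k
  calc r ^ n * ((n : ℝ) + x) ^ k ≤ r ^ n * (2 ^ (k - 1) * ((n : ℝ) ^ k + x ^ k)) := by gcongr
    _ = _ := by ring

lemma aux_hasSum (lam : ℂ) (x : ℝ) (hx : 0 < x) (d : ℝ)
    (hd : ‖lam‖ * Real.exp d < 1) (k : ℕ) :
    ∀ t ∈ Metric.ball (0 : ℂ) d,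
      HasSum (fun n : ℕ => 2 * ((-lam) ^ n * ((n : ℂ) + x) ^ k * Complex.exp (((n : ℂ) + x) * t)))
      (iteratedDeriv k
        (fun t : ℂ => 2 * Complex.exp ((x : ℂ) * t) / (lam * Complex.exp t + 1)) t) := by
  have hre : ∀ t ∈ Metric.ball (0 : ℂ) d, t.re ≤ d := fun t ht =>
    (Complex.re_le_norm t).trans ((mem_ball_zero_iff.1 ht).le)
  induction k with
  | zero =>
    intro t ht
    have hn : ‖-lam * Complex.exp t‖ < 1 := by
      rw [norm_mul, norm_neg, Complex.norm_exp]
      refine lt_of_le_of_lt ?_ hd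
      gcongr
      exact hre t ht
    have := (hasSum_geometric_of_norm_lt_one hn).mul_left (2 * Complex.exp (x * t))
    convert! this using 1
    · funext n
      rw [add_mul, Complex.exp_add, Complex.exp_nat_mul, mul_pow]
      ring
    · rw [iteratedDeriv_zero, div_eq_mul_inv]
      congr 2
      ring
  | succ k ih =>
    intro t ht
    have key := Complex.hasSum_deriv_of_summable_norm (U := Metric.ball (0 : ℂ) d)
      (F := fun (n : ℕ) (t : ℂ) =>
        2 * ((-lam) ^ n * ((n : ℂ) + x) ^ k * Complex.exp (((n : ℂ) + x) * t)))
      (u := fun n : ℕ => 2 * Real.exp (x * d) *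
        ((‖lam‖ * Real.exp d) ^ n * ((n : ℝ) + x) ^ k))
      ((aux_summable _ x (by positivity) hd hx k).mul_left _)
      (fun n => by fun_prop) Metric.isOpen_ball
      (fun n w hw => by
        have e1 : ‖(n : ℂ) + x‖ = (n : ℝ) + x := by
          have : (n : ℂ) + x = (((n : ℝ) + x : ℝ) : ℂ) := by push_cast; rfl
          rw [this, Complex.norm_of_nonneg (by positivity)]
        have e2 : ‖Complex.exp (((n : ℂ) + x) * w)‖ ≤ Real.exp (x * d) * Real.exp d ^ n := by
          rw [Complex.norm_exp, ← Real.exp_nat_mul, ← Real.exp_add]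
          apply Real.exp_le_exp.2
          have := hre w hw
          have h3 : (((n : ℂ) + x) * w).re = ((n : ℝ) + x) * w.re := by simp
          rw [h3]
          have : ((n : ℝ) + x) * w.re ≤ ((n : ℝ) + x) * d := by gcongr
          linarith
        simp only [norm_mul, norm_pow, norm_neg, e1, Complex.norm_ofNat]
        calc _ ≤ 2 * (‖lam‖ ^ n * ((n : ℝ) + x) ^ k * (Real.exp (x * d) * Real.exp d ^ n)) := by
              gcongr
          _ = _ := by ring) ht
    rw [iteratedDeriv_succ]
    convert! key using 1
    · funext n
      have h : HasDerivAt (fun t : ℂ =>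
          2 * ((-lam) ^ n * ((n : ℂ) + x) ^ k * Complex.exp (((n : ℂ) + x) * t)))
          (2 * ((-lam) ^ n * ((n : ℂ) + x) ^ k *
            (Complex.exp (((n : ℂ) + x) * t) * (((n : ℂ) + x) * 1)))) t :=
        ((((hasDerivAt_id t).const_mul ((n : ℂ) + x)).cexp).const_mul _).const_mul 2
      rw [h.deriv]
      ring
    · apply Filter.EventuallyEq.deriv_eq
      filter_upwards [Metric.isOpen_ball.mem_nhds ht] with w hw
      exact (ih w hw).tsum_eq.symm

/-- **Corollary 6.** For `|λ| < 1`, real `x > 0` and `k ∈ ℕ`, the value `ζ_λ(-k, x)`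
equals `E_k(λ; x)`, the `k`-th derivative at `t = 0` of `t ↦ 2 e^{xt}/(λ e^t + 1)`. -/
theorem lambdaZeta_neg_nat (lam : ℂ) (hlam : ‖lam‖ < 1) (x : ℝ) (hx : 0 < x) (k : ℕ) :
    lambdaZeta lam x (-(k : ℂ)) =
      iteratedDeriv k
        (fun t : ℂ => 2 * Complex.exp ((x : ℂ) * t) / (lam * Complex.exp t + 1)) 0 := by
  obtain ⟨d, hd, hd0⟩ : ∃ d : ℝ, ‖lam‖ * Real.exp d < 1 ∧ 0 < d := by
    have hc : Continuous (fun d : ℝ => ‖lam‖ * Real.exp d) := by fun_prop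
    have h : ∀ᶠ d in nhds (0 : ℝ), ‖lam‖ * Real.exp d < 1 :=
      hc.continuousAt.eventually_lt continuousAt_const (by simpa using hlam)
    exact ((h.filter_mono nhdsWithin_le_nhds).and
      (self_mem_nhdsWithin (a := (0 : ℝ)) (s := Set.Ioi 0))).exists
  have := aux_hasSum lam x hx d hd k 0 (Metric.mem_ball_self hd0)
  rw [← this.tsum_eq, tsum_mul_left, lambdaZeta]
  congr 2
  funext n
  rw [neg_neg, Complex.cpow_natCast, neg_pow lam]
  simp
end

section
/- Let λ ∈ ℂ with |λ| < 1, let n be a positive even integer, and let m ∈ ℕ. Then 2 ∑_{l=0}^{n-1} (-1)^{l-1} λ^l l^m = λ^n ∑_{l=0}^{m-1} binom(m,l) E_l(λ) n^{m-l} + (λ^n − 1) E_m(λ). -/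
/-- The `λ`-Euler numbers `E_k(λ) = 2 ∑_{j=0}^∞ (-1)^j λ^j j^k`
(absolutely convergent for `|λ| < 1`, with the convention `0^0 = 1`). -/
noncomputable def lambdaEulerNum (lam : ℂ) (k : ℕ) : ℂ :=
  2 * ∑' j : ℕ, (-1) ^ j * lam ^ j * (j : ℂ) ^ k

/-- **Theorem 5.** For `|λ| < 1`, `n` a positive even integer and `m ∈ ℕ`,
`2 ∑_{l=0}^{n-1} (-1)^{l-1} λ^l l^m
  = λ^n ∑_{l=0}^{m-1} C(m,l) E_l(λ) n^{m-l} + (λ^n - 1) E_m(λ)`. -/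
theorem lambdaEuler_alternating_power_sum (lam : ℂ) (hlam : ‖lam‖ < 1)
    (n : ℕ) (hn : 0 < n) (hne : Even n) (m : ℕ) :
    2 * ∑ l ∈ Finset.range n, (-1 : ℂ) ^ (l + 1) * lam ^ l * (l : ℂ) ^ m =
      lam ^ n * ∑ l ∈ Finset.range m,
          (m.choose l : ℂ) * lambdaEulerNum lam l * (n : ℂ) ^ (m - l)
        + (lam ^ n - 1) * lambdaEulerNum lam m := by
  have hs : ∀ k : ℕ, Summable (fun j : ℕ => (-1 : ℂ) ^ j * lam ^ j * (j : ℂ) ^ k) := by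
    intro k
    have h := summable_pow_mul_geometric_of_norm_lt_one (R := ℂ) k (r := -lam) (by simpa using hlam)
    refine h.congr fun j => ?_
    rw [neg_pow lam j]
    ring
  have h1 := (hs m).sum_add_tsum_nat_add n
  have h2 : ∑' j : ℕ, (-1 : ℂ) ^ (j + n) * lam ^ (j + n) * ((j + n : ℕ) : ℂ) ^ m
      = ∑ l ∈ Finset.range (m + 1), lam ^ n * (m.choose l : ℂ) * (n : ℂ) ^ (m - l) *
        ∑' j : ℕ, (-1 : ℂ) ^ j * lam ^ j * (j : ℂ) ^ l := by
    simp_rw [← tsum_mul_left]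
    rw [← Summable.tsum_finsetSum (fun l _ => (hs l).mul_left _)]
    refine tsum_congr fun j => ?_
    push_cast
    rw [add_pow, pow_add, pow_add, hne.neg_one_pow, Finset.mul_sum]
    refine Finset.sum_congr rfl fun l _ => ?_
    ring
  rw [h2, Finset.sum_range_succ] at h1
  have h3 : ∑ l ∈ Finset.range n, (-1 : ℂ) ^ (l + 1) * lam ^ l * (l : ℂ) ^ m
      = -∑ l ∈ Finset.range n, (-1 : ℂ) ^ l * lam ^ l * (l : ℂ) ^ m := by
    rw [← Finset.sum_neg_distrib]
    refine Finset.sum_congr rfl fun l _ => ?_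
    ring
  have h4 : lam ^ n * ∑ l ∈ Finset.range m,
          (m.choose l : ℂ) * lambdaEulerNum lam l * (n : ℂ) ^ (m - l)
      = 2 * ∑ l ∈ Finset.range m, lam ^ n * (m.choose l : ℂ) * (n : ℂ) ^ (m - l) *
        ∑' j : ℕ, (-1 : ℂ) ^ j * lam ^ j * (j : ℂ) ^ l := by
    rw [Finset.mul_sum, Finset.mul_sum]
    refine Finset.sum_congr rfl fun l _ => ?_
    rw [lambdaEulerNum]
    ring
  rw [h3, h4, lambdaEulerNum]
  simp only [Nat.choose_self, Nat.sub_self, pow_zero, Nat.cast_one, mul_one] at h1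
  linear_combination (-2 : ℂ) * h1
end

section
/- For all integers r ≥ 1 and natural numbers j, k with j + k > 0 and r + k ≠ 1, the following identity of generalized binomial coefficients holds in ℚ: (1/(r+k−1)) · C(−r, k) · C(1−r−k, j) = (−1/(j+k)) · C(−r, k+j−1) · C(k+j, j). -/
theorem choose_step (a : ℚ) (m : ℕ) :
    Ring.choose a (m + 1) = Ring.choose a m * (a - m) / (m + 1) := by
  have h := Ring.choose_add_smul_choose (a - m) 1 m
  have h2 : a - (m : ℚ) + m = a := by ring
  rw [h2, Ring.choose_one_right, add_comm 1 m, Nat.choose_succ_self_right, nsmul_eq_mul] at h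
  have h3 : (m : ℚ) + 1 ≠ 0 := by positivity
  rw [eq_div_iff h3, ← h]
  push_cast
  ring

theorem nat_step (k j : ℕ) : (((k + (j + 1)).choose (j + 1) : ℕ) : ℚ)
    = ((k + j).choose j : ℕ) * (k + j + 1) / (j + 1) := by
  have h := Nat.add_one_mul_choose_eq (k + j) j
  have h3 : (j : ℚ) + 1 ≠ 0 := by positivity
  rw [eq_div_iff h3, ← add_assoc]
  have h' : (((k + j + 1) * (k + j).choose j : ℕ) : ℚ)
    = ((k + j + 1).choose (j + 1) * (j + 1) : ℕ) := by rw [h]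
  push_cast at h'
  linarith

/-- **Binomial coefficient identity (first).** For integers `r ≥ 1` and naturals
`j, k` with `j + k > 0` and `r + k ≠ 1`, one has in `ℚ`:
`(1/(r+k-1)) C(-r, k) C(1-r-k, j) = (-1/(j+k)) C(-r, k+j-1) C(k+j, j)`,
where `C(a, m)` is the binomial-ring binomial coefficient on `ℚ`
(the descending factorial `a(a-1)⋯(a-m+1)` divided by `m!`). -/
theorem ring_choose_identity_one (r : ℕ) (hr : 1 ≤ r) (j k : ℕ)
    (hjk : 0 < j + k) (hrk : r + k ≠ 1) :
    (1 / ((r : ℚ) + (k : ℚ) - 1)) * Ring.choose (-(r : ℚ)) k *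
        Ring.choose (1 - (r : ℚ) - (k : ℚ)) j
      = (-1 / ((j : ℚ) + (k : ℚ))) * Ring.choose (-(r : ℚ)) (k + j - 1) *
        Ring.choose (((k + j : ℕ) : ℚ)) j := by
  have hne : (r : ℚ) + k - 1 ≠ 0 := by
    intro h
    apply hrk
    have : ((r + k : ℕ) : ℚ) = (1 : ℕ) := by push_cast; linarith
    exact_mod_cast this
  rw [Ring.choose_natCast]
  induction j with
  | zero =>
    obtain ⟨k, rfl⟩ : ∃ n, k = n + 1 := ⟨k - 1, by omega⟩
    have h1 : (k : ℚ) + 1 ≠ 0 := by positivity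
    simp only [Ring.choose_zero_right, add_zero, Nat.add_sub_cancel, Nat.choose_zero_right]
    rw [choose_step]
    push_cast at hne ⊢
    field_simp
    ring
  | succ j ih =>
    by_cases h0 : j + k = 0
    · obtain ⟨rfl, rfl⟩ : j = 0 ∧ k = 0 := by omega
      simp at hne ⊢
      field_simp
      ring
    · have ih := ih (by omega)
      obtain ⟨n, hn⟩ : ∃ n, k + j = n + 1 := ⟨k + j - 1, by omega⟩
      have e1 : k + (j + 1) - 1 = n + 1 := by omega
      have e2 : k + j - 1 = n := by omega
      rw [choose_step _ j, nat_step, e1, choose_step _ n]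
      rw [e2] at ih
      have hnq : (n : ℚ) = k + j - 1 := by
        have : ((k + j : ℕ) : ℚ) = (n + 1 : ℕ) := by rw [hn]
        push_cast at this
        linarith
      have hj : (j : ℚ) + 1 ≠ 0 := by positivity
      have hk : (k : ℚ) + j ≠ 0 := by
        have : (0 : ℚ) < (n : ℚ) + 1 := by positivity
        intro h
        linarith
      have hk2 : (j : ℚ) + k ≠ 0 := by rwa [add_comm]
      have hk3 : (j : ℚ) + 1 + k ≠ 0 := by positivity
      generalize Ring.choose (-(r : ℚ)) n = A at *
      rw [hnq]
      push_cast
      trans (1 / ((r : ℚ) + (k : ℚ) - 1)) * Ring.choose (-(r : ℚ)) k *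
        Ring.choose (1 - (r : ℚ) - (k : ℚ)) j * ((1 - r - k - j) / (j + 1))
      · ring
      rw [ih]
      have hs : (k : ℚ) + j - 1 + 1 = j + k := by ring
      have hs2 : (k : ℚ) + j + 1 = j + 1 + k := by ring
      rw [hs, hs2]
      field_simp
      ring
end

section
/- For all integers r ≥ 1 and natural numbers j, k, the following identity of generalized binomial coefficients holds in ℚ: (r/(r+k)) · C(−r−1, k) · C(−r−k, j) = C(−r, k+j) · C(k+j, j). -/
theorem choose_shift_aux (a : ℚ) (k : ℕ) :
    a * Ring.choose (a - 1) k = (a - k) * Ring.choose a k := by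
  have h1 : (descPochhammer ℚ (k+1)).eval a = a * (descPochhammer ℚ k).eval (a - 1) := by
    rw [descPochhammer_succ_left]; simp
  have h2 := descPochhammer_succ_eval (S := ℚ) k a
  have h3 : ∀ b : ℚ, (descPochhammer ℤ k).smeval b = (descPochhammer ℚ k).eval b := by
    intro b
    rw [← Polynomial.aeval_eq_smeval, ← descPochhammer_map (algebraMap ℤ ℚ), Polynomial.eval_map_algebraMap]
  rw [Ring.choose_eq_smul, Ring.choose_eq_smul, h3, h3]
  simp only [smul_eq_mul]
  rw [h2] at h1
  linear_combination (-(k.factorial : ℚ)⁻¹) * h1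

/-- **Binomial coefficient identity (second).** For integers `r ≥ 1` and naturals
`j, k`, one has in `ℚ`:
`(r/(r+k)) C(-r-1, k) C(-r-k, j) = C(-r, k+j) C(k+j, j)`,
where `C(a, m)` is the binomial-ring binomial coefficient on `ℚ`
(the descending factorial `a(a-1)⋯(a-m+1)` divided by `m!`). -/
theorem ring_choose_identity_two (r : ℕ) (hr : 1 ≤ r) (j k : ℕ) :
    ((r : ℚ) / ((r : ℚ) + (k : ℚ))) * Ring.choose (-(r : ℚ) - 1) k *
        Ring.choose (-(r : ℚ) - (k : ℚ)) j
      = Ring.choose (-(r : ℚ)) (k + j) * Ring.choose (((k + j : ℕ) : ℚ)) j := by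
  have h := choose_shift_aux (-(r : ℚ)) k
  have h2 := Ring.choose_smul_choose (-(r : ℚ)) (Nat.le_add_right k j)
  have hpos : (r : ℚ) + k ≠ 0 := by positivity
  have e : (r : ℚ) / (r + k) * Ring.choose (-(r : ℚ) - 1) k = Ring.choose (-(r : ℚ)) k := by
    field_simp
    linear_combination -h
  rw [Nat.add_sub_cancel_left, nsmul_eq_mul] at h2
  rw [e, Ring.choose_natCast, ← h2, Nat.choose_symm_add]
  ring
end

section
/- Let p be an odd prime and a ∈ ℤ_p with |a|_p ≤ 1/p. Then the fermionic sums of the p-adic cosine and sine satisfy: lim_{N→∞} ∑_{x=0}^{p^N−1} (-1)^x cos_p(ax) = 1 and lim_{N→∞} ∑_{x=0}^{p^N−1} (-1)^x sin_p(ax) = − sin_p(a)/(cos_p(a) + 1), the limits being taken in ℚ_p. -/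
/-- The `p`-adic cosine `cos_p(z) = ∑_{n=0}^∞ (-1)^n z^{2n}/(2n)!`, convergent in
`ℚ_p` for `z ∈ ℤ_p` with `|z|_p ≤ 1/p`. -/
noncomputable def pCos (p : ℕ) [Fact p.Prime] (z : ℤ_[p]) : ℚ_[p] :=
  ∑' n : ℕ, (-1) ^ n * (z : ℚ_[p]) ^ (2 * n) / ((2 * n).factorial : ℚ_[p])

/-- The `p`-adic sine `sin_p(z) = ∑_{n=0}^∞ (-1)^n z^{2n+1}/(2n+1)!`, convergent in
`ℚ_p` for `z ∈ ℤ_p` with `|z|_p ≤ 1/p`. -/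
noncomputable def pSin (p : ℕ) [Fact p.Prime] (z : ℤ_[p]) : ℚ_[p] :=
  ∑' n : ℕ, (-1) ^ n * (z : ℚ_[p]) ^ (2 * n + 1) / (((2 * n + 1).factorial : ℚ_[p]))

section Helpers

variable {p : ℕ} [Fact p.Prime] {K : Type*} [NormedField K] [NormedAlgebra ℚ_[p] K]

/-- The exponential series. -/
noncomputable def expE {K : Type*} [NormedField K] (z : K) : K :=
  ∑' n : ℕ, z ^ n / (n.factorial : K)

lemma norm_natCast_eq (n : ℕ) : ‖(n : K)‖ = ‖(n : ℚ_[p])‖ := by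
  rw [← map_natCast (algebraMap ℚ_[p] K), norm_algebraMap']

lemma term_bound (hodd : Odd p) (z : K) (hz : ‖z‖ ≤ 1 / p) (n : ℕ) :
    ‖z ^ n / (n.factorial : K)‖ ≤ ((Real.sqrt p)⁻¹) ^ n := by
  have hp : p.Prime := Fact.out
  have hp3 : 3 ≤ p := by
    have := hp.two_le
    rcases hodd with ⟨k, hk⟩
    omega
  have hp0 : (0 : ℝ) < p := by exact_mod_cast hp.pos
  have hv : 2 * padicValNat p n.factorial ≤ n := by
    have h := sub_one_mul_padicValNat_factorial (p := p) n
    have : 2 * padicValNat p n.factorial ≤ (p - 1) * padicValNat p n.factorial :=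
      Nat.mul_le_mul_right _ (by omega)
    omega
  rw [norm_div, norm_pow, norm_natCast_eq (p := p),
    Padic.norm_eq_zpow_neg_valuation (by exact_mod_cast n.factorial_ne_zero),
    Padic.valuation_natCast, zpow_neg, zpow_natCast, div_inv_eq_mul]
  set v := padicValNat p n.factorial
  set s := Real.sqrt p with hs
  have hs2 : s ^ 2 = p := Real.sq_sqrt hp0.le
  have hs1 : 1 ≤ s := by
    rw [hs, Real.one_le_sqrt]; exact_mod_cast hp.one_le
  have hs0 : 0 < s := by linarith
  calc ‖z‖ ^ n * (p : ℝ) ^ v ≤ (1 / p) ^ n * (p : ℝ) ^ v := by gcongr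
    _ = (s⁻¹) ^ (2 * n) * s ^ (2 * v) := by rw [pow_mul, pow_mul, hs2, inv_pow, hs2, one_div]
    _ ≤ (s⁻¹) ^ (2 * n) * s ^ n := by gcongr
    _ = (s⁻¹) ^ n := by
      rw [two_mul, pow_add, mul_assoc, ← mul_pow, inv_mul_cancel₀ hs0.ne', one_pow, mul_one]

lemma summable_geo : Summable fun n : ℕ => ((Real.sqrt p)⁻¹) ^ n := by
  have hp : p.Prime := Fact.out
  apply summable_geometric_of_lt_one (by positivity)
  apply inv_lt_one_of_one_lt₀
  rw [Real.lt_sqrt (by norm_num)]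
  simpa using hp.one_lt

lemma summable_term (hodd : Odd p) (z : K) (hz : ‖z‖ ≤ 1 / p) :
    Summable fun n : ℕ => ‖z ^ n / (n.factorial : K)‖ :=
  Summable.of_nonneg_of_le (fun _ => norm_nonneg _) (term_bound hodd z hz) summable_geo

lemma expE_add [CompleteSpace K] [CharZero K] (hodd : Odd p) (x y : K) (hx : ‖x‖ ≤ 1 / p)
    (hy : ‖y‖ ≤ 1 / p) : expE (x + y) = expE x * expE y := by
  unfold expE
  rw [tsum_mul_tsum_eq_tsum_sum_antidiagonal_of_summable_norm (summable_term hodd x hx)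
    (summable_term hodd y hy)]
  congr 1
  ext n
  rw [(Commute.all x y).add_pow', Finset.sum_div]
  refine Finset.sum_congr rfl fun ij hij => ?_
  rw [← (Finset.HasAntidiagonal.mem_antidiagonal (n := n)).mp hij, nsmul_eq_mul]
  have h := Nat.add_choose_mul_factorial_mul_factorial ij.1 ij.2
  rw [Nat.choose_symm_add.symm] at h
  have h' : (((ij.1 + ij.2).choose ij.1 : ℕ) : K) * (ij.1.factorial : K) * (ij.2.factorial : K)
    = ((ij.1 + ij.2).factorial : K) := by exact_mod_cast h
  have h1 : (ij.1.factorial : K) ≠ 0 := by exact_mod_cast ij.1.factorial_ne_zero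
  have h2 : (ij.2.factorial : K) ≠ 0 := by exact_mod_cast ij.2.factorial_ne_zero
  have h3 : ((ij.1 + ij.2).factorial : K) ≠ 0 := by
    exact_mod_cast (ij.1 + ij.2).factorial_ne_zero
  field_simp
  rw [← h']
  ring

lemma expE_zero : expE (0 : K) = 1 := by
  unfold expE
  rw [tsum_eq_single 0]
  · simp
  · intro n hn; simp [hn]

lemma norm_natCast_mul_le (z : K) (hz : ‖z‖ ≤ 1 / p) (n : ℕ) : ‖(n : K) * z‖ ≤ 1 / p := by
  rw [norm_mul, norm_natCast_eq (p := p)]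
  have h : ‖(n : ℚ_[p])‖ ≤ 1 := by
    simpa using Padic.norm_int_le_one (p := p) (n : ℤ)
  calc _ ≤ 1 * ‖z‖ := by gcongr
    _ ≤ _ := by simpa using hz

lemma expE_nat_mul [CompleteSpace K] [CharZero K] (hodd : Odd p) (z : K) (hz : ‖z‖ ≤ 1 / p)
    (n : ℕ) : expE ((n : K) * z) = expE z ^ n := by
  induction n with
  | zero => simp [expE_zero]
  | succ k ih =>
    rw [pow_succ, ← ih, ← expE_add hodd _ _ (norm_natCast_mul_le z hz k) hz]
    push_cast
    ring_nf

lemma expE_tendsto [CompleteSpace K] (hodd : Odd p) (z : K) (hz : ‖z‖ ≤ 1 / p) :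
    Filter.Tendsto (fun N : ℕ => expE (((p ^ N : ℕ) : K) * z)) Filter.atTop (nhds 1) := by
  rw [← expE_zero (K := K)]
  unfold expE
  have hp : p.Prime := Fact.out
  apply tendsto_tsum_of_dominated_convergence (summable_geo (p := p))
  · intro n
    have h0 : Filter.Tendsto (fun N : ℕ => ((p ^ N : ℕ) : K) * z) Filter.atTop (nhds 0) := by
      have : Filter.Tendsto (fun N : ℕ => ((p : K)) ^ N) Filter.atTop (nhds 0) := by
        apply tendsto_pow_atTop_nhds_zero_of_norm_lt_one
        rw [norm_natCast_eq (p := p)]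
        exact Padic.norm_p_lt_one
      simpa using this.mul_const z
    exact (h0.pow n).div_const _
  · exact Filter.Eventually.of_forall fun N n =>
      term_bound hodd _ (norm_natCast_mul_le z hz _) n

lemma expE_I [CompleteSpace K] (hodd : Odd p) (i : K) (hi : i ^ 2 = -1) (a : ℤ_[p])
    (ha : ‖a‖ ≤ 1 / p) :
    expE (i * algebraMap ℚ_[p] K a) =
      algebraMap ℚ_[p] K (pCos p a) + i * algebraMap ℚ_[p] K (pSin p a) := by
  have hi1 : ‖i‖ = 1 := by
    have : ‖i‖ ^ 2 = 1 := by rw [← norm_pow, hi]; simp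
    exact (pow_eq_one_iff_of_nonneg (norm_nonneg _) two_ne_zero).mp this
  have hz : ‖i * algebraMap ℚ_[p] K a‖ ≤ 1 / p := by
    rw [norm_mul, hi1, norm_algebraMap', one_mul]; exact ha
  have hs := (summable_term hodd _ hz).of_norm
  have hsa := (summable_term (K := ℚ_[p]) hodd (a : ℚ_[p]) ha)
  have hin : ∀ n : ℕ, i ^ (2 * n) = (-1) ^ n := fun n => by rw [pow_mul, hi]
  have hC : Summable fun n : ℕ => (-1) ^ n * (a : ℚ_[p]) ^ (2 * n) / ((2 * n).factorial : ℚ_[p]) := by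
    apply Summable.of_norm
    refine (hsa.comp_injective (i := fun n : ℕ => 2 * n) (fun x y h => by simpa using h)).congr ?_
    intro n
    simp
  have hS : Summable fun n : ℕ =>
      (-1) ^ n * (a : ℚ_[p]) ^ (2 * n + 1) / ((2 * n + 1).factorial : ℚ_[p]) := by
    apply Summable.of_norm
    refine (hsa.comp_injective (i := fun n : ℕ => 2 * n + 1) (fun x y h => by simpa using h)).congr ?_
    intro n
    simp
  have hcont : Continuous (algebraMap ℚ_[p] K) := continuous_algebraMap _ _
  have h1 := hC.hasSum.map (algebraMap ℚ_[p] K) hcont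
  have h2 := (hS.hasSum.map (algebraMap ℚ_[p] K) hcont).mul_left i
  unfold expE pCos pSin
  refine HasSum.tsum_eq (HasSum.even_add_odd ?_ ?_)
  · convert h1 using 1
    funext n
    simp [mul_pow, hin]
  · refine Eq.mp (congrArg (fun f => HasSum f _) ?_) h2
    funext n
    simp only [Function.comp, map_div₀, map_mul, map_pow, map_neg, map_one, map_natCast, mul_pow,
      pow_succ i, hin]
    ring

lemma one_add_expE_ne [CompleteSpace K] [CharZero K] (hodd : Odd p) (z : K) (hz : ‖z‖ ≤ 1 / p) :
    1 + expE z ≠ 0 := by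
  intro h
  have h1 : expE z = -1 := by linear_combination h
  have h2 := expE_tendsto hodd z hz
  simp only [expE_nat_mul hodd z hz, h1, (hodd.pow).neg_one_pow] at h2
  have := tendsto_nhds_unique tendsto_const_nhds h2
  norm_num at this

lemma sum_tendsto [CompleteSpace K] [CharZero K] (hodd : Odd p) (z : K) (hz : ‖z‖ ≤ 1 / p) :
    Filter.Tendsto (fun N : ℕ => ∑ x ∈ Finset.range (p ^ N), (-1 : K) ^ x * expE ((x : K) * z))
      Filter.atTop (nhds (2 / (1 + expE z))) := by
  have hne := one_add_expE_ne hodd z hz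
  have h : ∀ N : ℕ, ∑ x ∈ Finset.range (p ^ N), (-1 : K) ^ x * expE ((x : K) * z) =
      (1 + expE (((p ^ N : ℕ) : K) * z)) / (1 + expE z) := by
    intro N
    simp only [expE_nat_mul hodd z hz, ← mul_pow]
    rw [eq_div_iff hne]
    have := geom_sum_mul (-1 * expE z) (p ^ N)
    rw [mul_pow, (hodd.pow).neg_one_pow] at this
    linear_combination -this
  simp only [h]
  have := ((expE_tendsto hodd z hz).const_add 1).div_const (1 + expE z)
  convert this using 2
  norm_num

lemma main_aux [CompleteSpace K] [CharZero K] (hodd : Odd p) (i : K) (hi : i ^ 2 = -1)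
    (a : ℤ_[p]) (ha : ‖a‖ ≤ 1 / p) :
    Filter.Tendsto
        (fun N : ℕ => ∑ x ∈ Finset.range (p ^ N), (-1 : ℚ_[p]) ^ x * pCos p (a * ((x : ℕ) : ℤ_[p])))
        Filter.atTop (nhds 1) ∧
      Filter.Tendsto
        (fun N : ℕ => ∑ x ∈ Finset.range (p ^ N), (-1 : ℚ_[p]) ^ x * pSin p (a * ((x : ℕ) : ℤ_[p])))
        Filter.atTop (nhds (-(pSin p a / (pCos p a + 1)))) := by
  have hemb : Topology.IsInducing (algebraMap ℚ_[p] K) :=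
    (algebraMap_isometry ℚ_[p] K).isUniformInducing.isInducing
  have hi' : (-i) ^ 2 = -1 := by rw [neg_sq, hi]
  have hi0 : i ≠ 0 := by rintro rfl; norm_num at hi
  have hin : ∀ j : K, j ^ 2 = -1 → ‖j * algebraMap ℚ_[p] K a‖ ≤ 1 / p := by
    intro j hj
    have hj1 : ‖j‖ = 1 := by
      have : ‖j‖ ^ 2 = 1 := by rw [← norm_pow, hj]; simp
      exact (pow_eq_one_iff_of_nonneg (norm_nonneg _) two_ne_zero).mp this
    rw [norm_mul, hj1, norm_algebraMap', one_mul]; exact ha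
  have hax : ∀ x : ℕ, ‖a * (x : ℤ_[p])‖ ≤ 1 / p := fun x => by
    rw [norm_mul]
    calc _ ≤ ‖a‖ * 1 := by gcongr; exact PadicInt.norm_le_one _
      _ ≤ _ := by simpa using ha
  have hx : ∀ j : K, j ^ 2 = -1 → ∀ x : ℕ, expE ((x : K) * (j * algebraMap ℚ_[p] K a)) =
      algebraMap ℚ_[p] K (pCos p (a * (x : ℤ_[p]))) +
        j * algebraMap ℚ_[p] K (pSin p (a * (x : ℤ_[p]))) := by
    intro j hj x
    rw [← expE_I hodd j hj _ (hax x)]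
    congr 1
    rw [PadicInt.coe_mul, PadicInt.coe_natCast, map_mul, map_natCast]
    ring
  have t1 := sum_tendsto hodd _ (hin i hi)
  have t2 := sum_tendsto hodd _ (hin (-i) hi')
  have n1 := one_add_expE_ne hodd _ (hin i hi)
  have n2 := one_add_expE_ne hodd _ (hin (-i) hi')
  have hprod : expE (i * algebraMap ℚ_[p] K a) * expE (-i * algebraMap ℚ_[p] K a) = 1 := by
    rw [← expE_add hodd _ _ (hin i hi) (hin (-i) hi'), ← expE_zero (K := K)]
    congr 1; ring
  simp only [hx i hi] at t1
  simp only [hx (-i) hi'] at t2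
  rw [expE_I hodd i hi a ha] at t1 n1 hprod
  rw [expE_I hodd (-i) hi' a ha] at t2 n2 hprod
  set c := algebraMap ℚ_[p] K (pCos p a) with hc
  set s := algebraMap ℚ_[p] K (pSin p a) with hs
  have hc1 : c + 1 ≠ 0 := by
    intro h
    apply mul_ne_zero n1 n2
    linear_combination hprod + 2 * h
  have h2 : (2 : K) ≠ 0 := two_ne_zero
  constructor
  · rw [hemb.tendsto_nhds_iff]
    have := (t1.add t2).div_const 2
    convert this using 1
    · ext N
      simp only [Function.comp, map_sum, map_mul, map_pow, map_neg, map_one,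
        ← Finset.sum_add_distrib, Finset.sum_div]
      refine Finset.sum_congr rfl fun x _ => ?_
      field_simp
      ring
    · rw [map_one]
      congr 1
      rw [div_add_div _ _ n1 n2]
      have e : (1 + (c + i * s)) * (1 + (c + -i * s)) = 2 * (c + 1) := by
        linear_combination hprod
      rw [e]
      field_simp
      ring
  · rw [hemb.tendsto_nhds_iff]
    have := (t1.sub t2).div_const (2 * i)
    convert this using 1
    · ext N
      simp only [Function.comp, map_sum, map_mul, map_pow, map_neg, map_one,
        ← Finset.sum_sub_distrib, Finset.sum_div]
      refine Finset.sum_congr rfl fun x _ => ?_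
      field_simp
      ring
    · rw [map_neg, map_div₀, map_add, map_one, ← hc, ← hs]
      congr 1
      rw [div_sub_div _ _ n1 n2]
      have e : (1 + (c + i * s)) * (1 + (c + -i * s)) = 2 * (c + 1) := by
        linear_combination hprod
      rw [e]
      field_simp
      ring

end Helpers

/-- **Proposition 12.** Let `p` be an odd prime and `a ∈ ℤ_p` with `|a|_p ≤ 1/p`. Then
the fermionic sums of the `p`-adic cosine and sine satisfy
`∫ cos_p(ax) dμ_{-1}(x) = 1` and `∫ sin_p(ax) dμ_{-1}(x) = - sin_p(a)/(cos_p(a) + 1)`,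
the integrals being the limits of `∑_{x=0}^{p^N-1} (-1)^x f(ax)` as `N → ∞`. -/
theorem fermionic_integral_cos_sin (p : ℕ) [Fact p.Prime] (hodd : Odd p)
    (a : ℤ_[p]) (ha : ‖a‖ ≤ 1 / p) :
    Filter.Tendsto
        (fun N : ℕ => ∑ x ∈ Finset.range (p ^ N), (-1 : ℚ_[p]) ^ x * pCos p (a * ((x : ℕ) : ℤ_[p])))
        Filter.atTop (nhds 1) ∧
      Filter.Tendsto
        (fun N : ℕ => ∑ x ∈ Finset.range (p ^ N), (-1 : ℚ_[p]) ^ x * pSin p (a * ((x : ℕ) : ℤ_[p])))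
        Filter.atTop (nhds (-(pSin p a / (pCos p a + 1)))) := by
  obtain ⟨i, hi⟩ := IsAlgClosed.exists_pow_nat_eq (-1 : ℂ_[p]) (n := 2) (by norm_num)
  exact main_aux (K := ℂ_[p]) hodd i hi a ha
end

section
/- For every real number a with |a| < π, tan(a/2) = ∑_{n=0}^∞ (-1)^{n+1} E_{2n+1} a^{2n+1}/(2n+1)!, where E_m denotes the m-th Euler number, i.e. the m-th iterated derivative at t = 0 of the function t ↦ 2/(e^t + 1). -/
/-- The Euler numbers `E_m`, defined as the Taylor coefficients of `2/(e^t + 1)`: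
`E_m` is the `m`-th iterated derivative at `0` of `t ↦ 2/(e^t + 1)`. -/
noncomputable def eulerNum (m : ℕ) : ℝ :=
  iteratedDeriv m (fun t : ℝ => 2 / (Real.exp t + 1)) 0

/-- The complex generating function. -/
noncomputable def eulerGen (z : ℂ) : ℂ := 2 / (Complex.exp z + 1)

theorem eulerGen_den_ne {z : ℂ} (hz : |z.im| < Real.pi) : Complex.exp z + 1 ≠ 0 := by
  intro h
  have h1 : Complex.exp z = Complex.exp (Real.pi * Complex.I) := by
    rw [Complex.exp_pi_mul_I]; exact eq_neg_of_add_eq_zero_left h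
  rw [Complex.exp_eq_exp_iff_exists_int] at h1
  obtain ⟨k, hk⟩ := h1
  have h2 := congrArg Complex.im hk
  simp at h2
  have hp := Real.pi_pos
  rw [abs_lt, h2] at hz
  have h3 : (-1 : ℝ) < k := by nlinarith [hz.1]
  have h4 : (k : ℝ) < 0 := by nlinarith [hz.2]
  have h5 : (-1 : ℤ) < k := by exact_mod_cast h3
  have h6 : k < 0 := by exact_mod_cast h4
  omega

theorem eulerGen_diff {z : ℂ} (hz : |z.im| < Real.pi) : DifferentiableAt ℂ eulerGen z := by
  unfold eulerGen
  have := eulerGen_den_ne hz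
  fun_prop (disch := assumption)

theorem eulerGen_analytic {z : ℂ} (hz : |z.im| < Real.pi) : AnalyticAt ℂ eulerGen z := by
  unfold eulerGen
  have := eulerGen_den_ne hz
  fun_prop (disch := assumption)

theorem iteratedDeriv_eulerGen (m : ℕ) : ∀ x : ℝ, iteratedDeriv m eulerGen (x : ℂ) =
    ((iteratedDeriv m (fun t : ℝ => 2 / (Real.exp t + 1)) x : ℝ) : ℂ) := by
  have hpos : ∀ t : ℝ, Real.exp t + 1 ≠ 0 := fun t => by positivity
  have hsm : ContDiff ℝ (m + 1 : ℕ) (fun t : ℝ => 2 / (Real.exp t + 1)) := by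
    fun_prop (disch := assumption)
  induction m with
  | zero => intro x; simp [eulerGen]
  | succ m ih =>
    intro x
    have hsm' : ContDiff ℝ (m + 1 : ℕ) (fun t : ℝ => 2 / (Real.exp t + 1)) := by
      fun_prop (disch := assumption)
    have hA : AnalyticAt ℂ eulerGen (x : ℂ) := eulerGen_analytic (by simp [Real.pi_pos])
    have h1 : HasDerivAt (iteratedDeriv m eulerGen) (iteratedDeriv (m + 1) eulerGen x) (x : ℂ) := by
      rw [iteratedDeriv_succ]
      exact (by rw [iteratedDeriv_eq_iterate]; exact hA.iterated_deriv m : AnalyticAt ℂ (iteratedDeriv m eulerGen) (x : ℂ)).differentiableAt.hasDerivAt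
    have h2 := h1.comp_ofReal
    have h3 : HasDerivAt (iteratedDeriv m (fun t : ℝ => 2 / (Real.exp t + 1)))
        (iteratedDeriv (m + 1) (fun t : ℝ => 2 / (Real.exp t + 1)) x) x := by
      rw [iteratedDeriv_succ]
      exact (hsm'.differentiable_iteratedDeriv m (by exact_mod_cast Nat.lt_succ_self m) x).hasDerivAt
    have h4 := h3.ofReal_comp
    have h5 : (fun y : ℝ => iteratedDeriv m eulerGen (y : ℂ)) = _ := funext (ih hsm')
    rw [h5] at h2
    exact h2.unique h4

theorem eulerGen_im (a : ℝ) (ha : |a| < Real.pi) :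
    (eulerGen (a * Complex.I)).im = - Real.tan (a / 2) := by
  have hc : 0 < Real.cos (a / 2) := by
    rw [abs_lt] at ha
    exact Real.cos_pos_of_mem_Ioo ⟨by linarith, by linarith⟩
  have hc' : (Real.cos (a / 2) : ℂ) ≠ 0 := by exact_mod_cast hc.ne'
  have hd : Complex.exp (a * Complex.I) + 1 ≠ 0 := eulerGen_den_ne (by simpa using ha)
  have key : eulerGen (a * Complex.I) = 1 - (Real.tan (a / 2) : ℝ) * Complex.I := by
    unfold eulerGen
    rw [div_eq_iff hd, Real.tan_eq_sin_div_cos]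
    have e : Complex.exp (a * Complex.I)
        = (Real.cos (a / 2) + Real.sin (a / 2) * Complex.I) ^ 2 := by
      rw [Complex.ofReal_cos, Complex.ofReal_sin, ← Complex.exp_mul_I, ← Complex.exp_nat_mul]
      congr 1; push_cast; ring
    have p : (Real.sin (a / 2) : ℂ) ^ 2 + (Real.cos (a / 2) : ℂ) ^ 2 = 1 := by
      exact_mod_cast Real.sin_sq_add_cos_sq (a / 2)
    rw [e, Complex.ofReal_div]
    generalize (Real.sin (a / 2) : ℂ) = s at *
    generalize (Real.cos (a / 2) : ℂ) = c at *
    field_simp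
    have hI := Complex.I_sq
    have hd2 : (c + s * Complex.I) ^ 2 + 1 = 2 * c * (c + s * Complex.I) := by
      linear_combination s ^ 2 * hI - p
    rw [hd2]
    linear_combination (-2 * c) * p + 2 * c * s ^ 2 * hI
  rw [key, Complex.sub_im, Complex.im_ofReal_mul, Complex.I_im, Complex.one_im]
  ring

/-- **Theorem 13.** For every real `a` with `|a| < π`,
`tan(a/2) = ∑_{n=0}^∞ (-1)^{n+1} E_{2n+1} a^{2n+1}/(2n+1)!`. -/
theorem tan_half_eq_euler_series (a : ℝ) (ha : |a| < Real.pi) :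
    Real.tan (a / 2) =
      ∑' n : ℕ, (-1 : ℝ) ^ (n + 1) * eulerNum (2 * n + 1) * a ^ (2 * n + 1) /
        ((2 * n + 1).factorial : ℝ) := by
  have hD : DifferentiableOn ℂ eulerGen (Metric.ball 0 Real.pi) := fun z hz =>
    (eulerGen_diff (lt_of_le_of_lt (Complex.abs_im_le_norm z)
      (by simpa using hz))).differentiableWithinAt
  have hz : (a * Complex.I : ℂ) ∈ Metric.ball (0 : ℂ) Real.pi := by simpa using ha
  have H := Complex.hasSum_taylorSeries_on_ball hD hz
  have H2 := (Complex.hasSum_im H).neg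
  rw [eulerGen_im a ha, neg_neg] at H2
  have hI : ∀ n : ℕ, Complex.I ^ (2 * n) = (((-1 : ℝ) ^ n : ℝ) : ℂ) := fun n => by
    rw [pow_mul, Complex.I_sq]; push_cast; rfl
  have h0 : ∀ m, iteratedDeriv m eulerGen 0 = (eulerNum m : ℂ) := fun m => by
    simpa [eulerNum] using iteratedDeriv_eulerGen m 0
  have hinj : Function.Injective (fun n : ℕ => 2 * n + 1) := fun x y h => by
    simp at h; exact h
  rw [← hinj.hasSum_iff] at H2
  · rw [← H2.tsum_eq]
    refine tsum_congr fun n => ?_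
    have : ((((2 * n + 1).factorial : ℂ))⁻¹ • (a * Complex.I - 0) ^ (2 * n + 1) •
        iteratedDeriv (2 * n + 1) eulerGen 0) =
        (((((2 * n + 1).factorial : ℝ))⁻¹ * a ^ (2 * n + 1) * (-1) ^ n * eulerNum (2 * n + 1) : ℝ) : ℂ)
          * Complex.I := by
      rw [h0, sub_zero, mul_pow, pow_succ Complex.I, hI]
      simp only [smul_eq_mul]; push_cast; ring
    simp only [Function.comp_apply]
    rw [this, Complex.im_ofReal_mul, Complex.I_im]
    ring
  · intro m hm
    rcases Nat.even_or_odd' m with ⟨k, rfl | rfl⟩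
    · have : ((((2 * k).factorial : ℂ))⁻¹ • (a * Complex.I - 0) ^ (2 * k) •
          iteratedDeriv (2 * k) eulerGen 0) =
          (((((2 * k).factorial : ℝ))⁻¹ * a ^ (2 * k) * (-1) ^ k * eulerNum (2 * k) : ℝ) : ℂ) := by
        rw [h0, sub_zero, mul_pow, hI]
        simp only [smul_eq_mul]; push_cast; ring
      rw [this, Complex.ofReal_im, neg_zero]
    · exact absurd ⟨k, rfl⟩ hm
end

section
/- For every real number a with 0 < |a| < 2π, (a/2) · cot(a/2) = ∑_{n=0}^∞ (-1)^n B_{2n} a^{2n}/(2n)!, where B_m denotes the m-th Bernoulli number and cot(a/2) = cos(a/2)/sin(a/2). -/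
open Real in
lemma cot_real_hasSum (x : ℝ) (h0 : x ≠ 0) (h1 : |x| < 1) :
    HasSum (fun n : ℕ => x ^ 2 / (((n : ℝ) + 1) ^ 2 - x ^ 2))
      ((1 - π * x * (Real.cos (π * x) / Real.sin (π * x))) / 2) := by
  have hx : (x : ℂ) ∈ Complex.integerComplement := by
    rw [Complex.mem_integerComplement_iff]
    rintro ⟨m, hm⟩
    have hm' : (m : ℝ) = x := by exact_mod_cast hm
    rw [← hm'] at h0 h1
    have h2 : |m| < 1 := by exact_mod_cast h1
    have h3 : m = 0 := Int.abs_lt_one_iff.mp h2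
    simp [h3] at h0
  have hs := (summable_cotTerm hx).hasSum
  rw [show (∑' n : ℕ, cotTerm (x : ℂ) n) = π * Complex.cot (π * x) - 1 / x from
    (cot_series_rep' hx).symm] at hs
  have hs2 := hs.mul_left (-(x : ℂ) / 2)
  rw [← Complex.hasSum_ofReal]
  have hxc : (x : ℂ) ≠ 0 := by exact_mod_cast h0
  convert! hs2 using 1
  · ext n
    rw [cotTerm_identity hx]
    have h1 : (x : ℂ) + (n + 1) ≠ 0 := by
      simpa using Complex.integerComplement_add_ne_zero hx ((n : ℤ) + 1)
    have h2 : (x : ℂ) - (n + 1) ≠ 0 := by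
      simpa [sub_eq_add_neg] using Complex.integerComplement_add_ne_zero hx (-(n + 1) : ℤ)
    have h3 : ((n : ℂ) + 1) ^ 2 - x ^ 2 = -((x + (n + 1)) * (x - (n + 1))) := by ring
    push_cast
    rw [h3]
    field_simp
  · rw [Complex.cot_eq_cos_div_sin]
    push_cast
    field_simp
    ring

open Real in
lemma cot_real_series (x : ℝ) (h0 : x ≠ 0) (h1 : |x| < 1) :
    HasSum (fun k : ℕ => x ^ (2 * (k + 1)) * ((-1 : ℝ) ^ (k + 1 + 1) *
        (2 : ℝ) ^ (2 * (k + 1) - 1) * π ^ (2 * (k + 1)) *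
        bernoulli (2 * (k + 1)) / (2 * (k + 1)).factorial))
      ((1 - π * x * (Real.cos (π * x) / Real.sin (π * x))) / 2) := by
  have H := cot_real_hasSum x h0 h1
  have hx2 : x ^ 2 < 1 := by rwa [sq_lt_one_iff_abs_lt_one]
  let f : ℕ × ℕ → ℝ := fun p => (x ^ 2 / ((p.1 : ℝ) + 1) ^ 2) ^ (p.2 + 1)
  have row : ∀ n : ℕ, HasSum (fun k => f (n, k)) (x ^ 2 / (((n : ℝ) + 1) ^ 2 - x ^ 2)) := by
    intro n
    have hn : (1 : ℝ) ≤ ((n : ℝ) + 1) ^ 2 := one_le_pow₀ (by linarith [n.cast_nonneg (α := ℝ)])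
    have hr : x ^ 2 / ((n : ℝ) + 1) ^ 2 < 1 := by
      rw [div_lt_one (by linarith)]; linarith
    have := (hasSum_geometric_of_lt_one (by positivity) hr).mul_left (x ^ 2 / ((n : ℝ) + 1) ^ 2)
    convert! this using 1
    · ext k; simp only [f]; ring
    · have h3 : ((n : ℝ) + 1) ^ 2 - x ^ 2 ≠ 0 := by linarith
      have h4 : ((n : ℝ) + 1) ^ 2 ≠ 0 := by linarith
      rw [one_sub_div h4]
      field_simp
  have hf : Summable f := by
    refine (summable_prod_of_nonneg (fun p => by simp only [f]; positivity)).mpr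
      ⟨fun n => (row n).summable, ?_⟩
    exact H.summable.congr fun n => (row n).tsum_eq.symm
  have hS := hf.hasSum
  rw [(hS.prod_fiberwise row).unique H] at hS
  have hS' := (Equiv.prodComm ℕ ℕ).hasSum_iff.mpr hS
  refine hS'.prod_fiberwise fun k => ?_
  have hz := hasSum_zeta_nat (k := k + 1) (by omega)
  rw [← hasSum_nat_add_iff' 1] at hz
  have := hz.mul_left (x ^ (2 * (k + 1)))
  convert! this using 1
  · ext n
    simp only [f, Function.comp, Equiv.prodComm_apply, Prod.swap_prod_mk]
    rw [div_pow, ← pow_mul, ← pow_mul]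
    push_cast
    ring
  · simp

theorem half_mul_cot_half_eq_bernoulli_series (a : ℝ) (ha0 : 0 < |a|)
    (ha : |a| < 2 * Real.pi) :
    a / 2 * (Real.cos (a / 2) / Real.sin (a / 2)) =
      ∑' n : ℕ, (-1 : ℝ) ^ n * ((bernoulli (2 * n) : ℚ) : ℝ) * a ^ (2 * n) /
        ((2 * n).factorial : ℝ) := by
  have hpi := Real.pi_pos
  have ha' : a ≠ 0 := abs_pos.mp ha0
  have h := cot_real_series (a / (2 * Real.pi)) (by positivity) (by
    rw [abs_div, abs_of_pos (by positivity : 0 < 2 * Real.pi), div_lt_one (by positivity)]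
    exact ha)
  have e : Real.pi * (a / (2 * Real.pi)) = a / 2 := by field_simp
  rw [e] at h
  symm
  apply HasSum.tsum_eq
  rw [← hasSum_nat_add_iff' 1]
  convert! h.mul_left (-2) using 1
  · ext k
    rw [show 2 * (k + 1) - 1 = 2 * k + 1 by omega, div_pow, mul_pow,
      show (2 : ℝ) ^ (2 * (k + 1)) = 2 * 2 ^ (2 * k + 1) by ring]
    field_simp
    ring
  · simp
    ring
end
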